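/- In cases (BS1) and (BS2), the ordered group (Γ, Λ) is quasi-lattice ordered: for every t ∈ Γ with tΛ ∩ Λ ≠ ∅ (equivalently, t ∈ ΛΛ^{-1}), there exists α ∈ Λ such that tΛ ∩ Λ = αΛ. -/

import Mathlib

inductive BSGen : Type
  | a : BSGen
  | b : BSGen

/-- The relations for the Baumslag–Solitar presentation `⟨a, b | a bᶜ = bᵉ a⟩`.
For cases (BS1), (BS2) take `e = d`; for case (BS3) take `e = -d`. -/
def BSRel (c e : ℤ) : Set (FreeGroup BSGen) :=
  {FreeGroup.of BSGen.a * FreeGroup.of BSGen.b ^ c *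
    (FreeGroup.of BSGen.b ^ e * FreeGroup.of BSGen.a)⁻¹}

/-- The Baumslag–Solitar group `Γ = ⟨a, b | a bᶜ = bᵉ a⟩`. -/
abbrev BSGroup (c e : ℤ) := PresentedGroup (BSRel c e)

/-- The generator `a` of `Γ`. -/
def bsa (c e : ℤ) : BSGroup c e := PresentedGroup.of BSGen.a

/-- The generator `b` of `Γ`. -/
def bsb (c e : ℤ) : BSGroup c e := PresentedGroup.of BSGen.b

/-- `Λ`, the submonoid of `Γ` generated by `a` and `b`. -/
def bsΛ (c e : ℤ) : Submonoid (BSGroup c e) :=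
  Submonoid.closure {bsa c e, bsb c e}

/-- The product `bⁱ¹ a bⁱ² a ⋯ bⁱᵏ a` attached to a list of exponents. -/
def posWord {H : Type*} [Group H] (a b : H) (L : List ℤ) : H :=
  (L.map fun i => b ^ i * a).prod

theorem posWord_nil {H : Type*} [Group H] (a b : H) : posWord a b [] = 1 := rfl

theorem posWord_cons {H : Type*} [Group H] (a b : H) (i : ℤ) (L : List ℤ) :
    posWord a b (i :: L) = b ^ i * a * posWord a b L := by
  simp [posWord]

theorem posWord_concat {H : Type*} [Group H] (a b : H) (L : List ℤ) (i : ℤ) :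
    posWord a b (L ++ [i]) = posWord a b L * (b ^ i * a) := by
  simp [posWord]

theorem map_posWord {H K : Type*} [Group H] [Group K] (f : H →* K) (a b : H) (L : List ℤ) :
    f (posWord a b L) = posWord (f a) (f b) L := by
  induction L with
  | nil => simp [posWord]
  | cons i L ih => simp [posWord_cons, ih]

/-- The exponents all lie in `[0, d)`. -/
def IsDigitList (d : ℤ) (L : List ℤ) : Prop := ∀ i ∈ L, 0 ≤ i ∧ i < d

/-- The word `posWord L * b ^ m * (posWord L')⁻¹` contains no pinch `a b^(ck) a⁻¹`. -/
def IsPinchFree (c : ℤ) (L : List ℤ) (m : ℤ) (L' : List ℤ) : Prop :=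
  L ≠ [] → L' ≠ [] → ¬ c ∣ m

theorem IsPinchFree.tail {c i m : ℤ} {L L' : List ℤ} (h : IsPinchFree c (i :: L) m L') :
    IsPinchFree c L m L' :=
  fun _ => h (List.cons_ne_nil i L)

section Relations

variable {c d : ℤ}

theorem bsa_mul_bsb_zpow : bsa c d * bsb c d ^ c = bsb c d ^ d * bsa c d := by
  have h : PresentedGroup.mk (BSRel c d) (FreeGroup.of BSGen.a * FreeGroup.of BSGen.b ^ c *
      (FreeGroup.of BSGen.b ^ d * FreeGroup.of BSGen.a)⁻¹) = 1 :=
    PresentedGroup.one_of_mem rfl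
  rw [map_mul, map_inv, mul_inv_eq_one, map_mul, map_mul, map_zpow, map_zpow] at h
  exact h

theorem bsa_mul_bsb_zpow_mul (k : ℤ) :
    bsa c d * bsb c d ^ (c * k) = bsb c d ^ (d * k) * bsa c d := by
  have h : SemiconjBy (bsa c d) (bsb c d ^ c) (bsb c d ^ d) := bsa_mul_bsb_zpow
  simpa [zpow_mul] using (h.zpow_right k).eq

theorem bsa_mem : bsa c d ∈ bsΛ c d := Submonoid.subset_closure (by simp)

theorem bsb_zpow_mem {n : ℤ} (hn : 0 ≤ n) : bsb c d ^ n ∈ bsΛ c d := by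
  lift n to ℕ using hn
  rw [zpow_natCast]
  exact pow_mem (Submonoid.subset_closure (by simp)) n

theorem posWord_mem {L : List ℤ} (hL : IsDigitList d L) :
    posWord (bsa c d) (bsb c d) L ∈ bsΛ c d := by
  refine Submonoid.list_prod_mem _ fun x hx => ?_
  obtain ⟨i, hi, rfl⟩ := List.mem_map.1 hx
  exact mul_mem (bsb_zpow_mem (hL i hi).1) bsa_mem

theorem IsDigitList.concat {L : List ℤ} (hL : IsDigitList d L) {i : ℤ} (h0 : 0 ≤ i) (h1 : i < d) :
    IsDigitList d (L ++ [i]) := by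
  intro j hj
  rcases List.mem_append.1 hj with hj | hj
  · exact hL j hj
  · obtain rfl := List.mem_singleton.1 hj
    exact ⟨h0, h1⟩

theorem exists_posWord_of_mem (hc : 0 < c) (hd : 0 < d) {x : BSGroup c d} (hx : x ∈ bsΛ c d) :
    ∃ (L : List ℤ) (n : ℤ), IsDigitList d L ∧ 0 ≤ n ∧
      x = posWord (bsa c d) (bsb c d) L * bsb c d ^ n := by
  induction hx using Submonoid.closure_induction_right with
  | one => exact ⟨[], 0, by simp [IsDigitList], le_rfl, by simp [posWord]⟩
  | mul_right x _ y hy ih =>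
    obtain ⟨L, n, hL, hn, rfl⟩ := ih
    rcases hy with rfl | rfl
    · refine ⟨L ++ [n % d], c * (n / d),
        hL.concat (Int.emod_nonneg n hd.ne') (Int.emod_lt_of_pos n hd),
        mul_nonneg hc.le (Int.ediv_nonneg hn hd.le), ?_⟩
      rw [posWord_concat, mul_assoc, mul_assoc, mul_assoc, bsa_mul_bsb_zpow_mul, ← mul_assoc (_ ^ _),
        ← zpow_add, Int.emod_add_mul_ediv]
    · exact ⟨L, n + 1, hL, by lia, by rw [zpow_add_one, mul_assoc]⟩

/-- Cancelling common right factors of `posWord L * b ^ n` and `posWord L' * b ^ n'`. -/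
theorem exists_isPinchFree_of_posWord (hd : 0 < d) (L L' : List ℤ) (n n' : ℤ)
    (hL : IsDigitList d L) (hL' : IsDigitList d L') (hn : 0 ≤ n) (hn' : 0 ≤ n') :
    ∃ (M M' : List ℤ) (m : ℤ), IsDigitList d M ∧ IsDigitList d M' ∧ IsPinchFree c M m M' ∧
      ∃ z ∈ bsΛ c d,
        posWord (bsa c d) (bsb c d) L * bsb c d ^ n =
          posWord (bsa c d) (bsb c d) M * bsb c d ^ max m 0 * z ∧
        posWord (bsa c d) (bsb c d) L' * bsb c d ^ n' =
          posWord (bsa c d) (bsb c d) M' * bsb c d ^ max (-m) 0 * z := by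
  induction L using List.reverseRecOn generalizing L' n n' with
  | nil =>
    refine ⟨[], L', n - n', hL, hL', fun h => absurd rfl h, bsb c d ^ min n n',
      bsb_zpow_mem (le_min hn hn'), ?_, ?_⟩ <;>
    · rw [mul_assoc, ← zpow_add]
      congr 2
      lia
  | append_singleton L i ih =>
    by_cases hred : IsPinchFree c (L ++ [i]) (n - n') L'
    · refine ⟨L ++ [i], L', n - n', hL, hL', hred, bsb c d ^ min n n',
        bsb_zpow_mem (le_min hn hn'), ?_, ?_⟩ <;>
      · rw [mul_assoc, ← zpow_add]
        congr 2
        lia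
    · simp only [IsPinchFree, Classical.not_imp, not_not] at hred
      obtain ⟨-, hne, k, hk⟩ := hred
      obtain rfl | ⟨L', i', rfl⟩ := List.eq_nil_or_concat' L'
      · exact absurd rfl hne
      have hs : ∃ s : ℤ, 0 ≤ s ∧ n = c * max k 0 + s ∧ n' = c * max (-k) 0 + s := by
        rcases le_total 0 k with h | h
        · refine ⟨n', hn', ?_, ?_⟩
          · rw [max_eq_left h]; lia
          · rw [max_eq_right (by lia)]; simp
        · refine ⟨n, hn, ?_, ?_⟩
          · rw [max_eq_right h]; simp
          · rw [max_eq_left (by lia)]; linarith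
      obtain ⟨s, hs, rfl, rfl⟩ := hs
      have hp : 0 ≤ d * max k 0 := mul_nonneg hd.le (le_max_right _ _)
      have hq : 0 ≤ d * max (-k) 0 := mul_nonneg hd.le (le_max_right _ _)
      have hi := hL i (by simp)
      have hi' := hL' i' (by simp)
      obtain ⟨M, M', m, hM, hM', hred, z, hz, h₁, h₂⟩ :=
        ih L' (i + d * max k 0) (i' + d * max (-k) 0)
          (fun j hj => hL j (by simp [hj])) (fun j hj => hL' j (by simp [hj]))
          (by lia) (by lia)
      have key : ∀ (K : List ℤ) (j p : ℤ),
          posWord (bsa c d) (bsb c d) (K ++ [j]) * bsb c d ^ (c * p + s) =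
            posWord (bsa c d) (bsb c d) K * bsb c d ^ (j + d * p) * (bsa c d * bsb c d ^ s) := by
        intro K j p
        rw [posWord_concat, zpow_add _ (c * p), zpow_add _ j]
        simp only [mul_assoc]
        rw [← mul_assoc (bsa c d), bsa_mul_bsb_zpow_mul]
        simp only [mul_assoc]
      refine ⟨M, M', m, hM, hM', hred, z * (bsa c d * bsb c d ^ s),
        mul_mem hz (mul_mem bsa_mem (bsb_zpow_mem hs)), ?_, ?_⟩
      · rw [key, h₁, mul_assoc]
      · rw [key, h₂, mul_assoc]

theorem exists_isPinchFree_of_mem (hc : 0 < c) (hd : 0 < d) {u v : BSGroup c d}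
    (hu : u ∈ bsΛ c d) (hv : v ∈ bsΛ c d) :
    ∃ (M M' : List ℤ) (m : ℤ), IsDigitList d M ∧ IsDigitList d M' ∧ IsPinchFree c M m M' ∧
      ∃ z ∈ bsΛ c d,
        u = posWord (bsa c d) (bsb c d) M * bsb c d ^ max m 0 * z ∧
        v = posWord (bsa c d) (bsb c d) M' * bsb c d ^ max (-m) 0 * z := by
  obtain ⟨L, n, hL, hn, rfl⟩ := exists_posWord_of_mem hc hd hu
  obtain ⟨L', n', hL', hn', rfl⟩ := exists_posWord_of_mem hc hd hv
  exact exists_isPinchFree_of_posWord hd L L' n n' hL hL' hn hn'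

theorem mul_zpow_max_mul_inv {H : Type*} [Group H] (p q b : H) (m : ℤ) :
    p * b ^ max m 0 * (q * b ^ max (-m) 0)⁻¹ = p * b ^ m * q⁻¹ := by
  rw [mul_inv_rev, ← zpow_neg, ← mul_assoc, mul_assoc p, ← zpow_add]
  congr 3
  lia

end Relations

section Britton

variable {c d : ℤ}

/-- The subgroup of multiples of `n` in the infinite cyclic group. -/
abbrev mulSubgroup (n : ℤ) : Subgroup (Multiplicative ℤ) :=
  (zpowGroupHom n : Multiplicative ℤ →* Multiplicative ℤ).range

theorem ofAdd_mem_mulSubgroup {n m : ℤ} : Multiplicative.ofAdd m ∈ mulSubgroup n ↔ n ∣ m := by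
  constructor
  · rintro ⟨x, hx⟩
    refine ⟨x.toAdd, ?_⟩
    have := congrArg Multiplicative.toAdd hx
    simpa using this.symm
  · rintro ⟨k, rfl⟩
    exact ⟨Multiplicative.ofAdd k, by rw [zpowGroupHom_apply, ← ofAdd_zsmul, smul_eq_mul]⟩

theorem zpowGroupHom_injective {n : ℤ} (hn : 0 < n) :
    Function.Injective (zpowGroupHom n : Multiplicative ℤ →* Multiplicative ℤ) := by
  intro x y h
  have := congrArg Multiplicative.toAdd h
  simp only [zpowGroupHom_apply, toAdd_zpow, smul_eq_mul] at this
  exact Multiplicative.toAdd.injective (mul_left_cancel₀ hn.ne' this)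

/-- The isomorphism `cℤ ≃ dℤ` sending `c` to `d`. -/
noncomputable def mulSubgroupEquiv (hc : 0 < c) (hd : 0 < d) : mulSubgroup c ≃* mulSubgroup d :=
  (MonoidHom.ofInjective (zpowGroupHom_injective hc)).symm.trans
    (MonoidHom.ofInjective (zpowGroupHom_injective hd))

theorem mulSubgroupEquiv_apply (hc : 0 < c) (hd : 0 < d) (x : Multiplicative ℤ) :
    (mulSubgroupEquiv hc hd ⟨x ^ c, x, rfl⟩ : Multiplicative ℤ) = x ^ d := by
  have h : (⟨x ^ c, x, rfl⟩ : mulSubgroup c) =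
      MonoidHom.ofInjective (zpowGroupHom_injective hc) x := rfl
  rw [h, mulSubgroupEquiv, MulEquiv.trans_apply, MulEquiv.symm_apply_apply]
  rfl

/-- The Baumslag–Solitar group as an HNN extension of the infinite cyclic group. -/
abbrev BSExtension (hc : 0 < c) (hd : 0 < d) : Type :=
  HNNExtension (Multiplicative ℤ) (mulSubgroup c) (mulSubgroup d) (mulSubgroupEquiv hc hd)

variable (hc : 0 < c) (hd : 0 < d)

/-- The generator of the base group of `BSExtension`. -/
noncomputable def extBase : BSExtension hc hd := HNNExtension.of (Multiplicative.ofAdd 1)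

theorem of_ofAdd (m : ℤ) :
    (HNNExtension.of (Multiplicative.ofAdd m) : BSExtension hc hd) = extBase hc hd ^ m := by
  rw [extBase, ← map_zpow, ← ofAdd_zsmul, smul_eq_mul, mul_one]

theorem t_mul_extBase_zpow :
    (HNNExtension.t : BSExtension hc hd) * extBase hc hd ^ c =
      extBase hc hd ^ d * HNNExtension.t := by
  have h := HNNExtension.t_mul_of (φ := mulSubgroupEquiv hc hd)
    ⟨Multiplicative.ofAdd 1 ^ c, _, rfl⟩
  rw [mulSubgroupEquiv_apply] at h
  simpa [extBase] using h

/-- The images of the two generators in `BSExtension`. -/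
noncomputable def extGen : BSGen → BSExtension hc hd
  | BSGen.a => HNNExtension.t
  | BSGen.b => extBase hc hd

theorem lift_extGen_eq_one :
    ∀ r ∈ BSRel c d, FreeGroup.lift (extGen hc hd) r = 1 := by
  rintro r rfl
  simp only [map_mul, map_inv, map_zpow, FreeGroup.lift_apply_of, extGen]
  rw [mul_inv_eq_one, t_mul_extBase_zpow]

/-- The natural homomorphism from the presented group to the HNN extension. -/
noncomputable def toExtension : BSGroup c d →* BSExtension hc hd :=
  PresentedGroup.toGroup (lift_extGen_eq_one hc hd)

theorem toExtension_bsa : toExtension hc hd (bsa c d) = HNNExtension.t :=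
  PresentedGroup.toGroup.of _

theorem toExtension_bsb : toExtension hc hd (bsb c d) = extBase hc hd :=
  PresentedGroup.toGroup.of _

/-- The syllables of the word `posWord L * b ^ m * (posWord L')⁻¹` after its initial power of
`b`. -/
def syllables (m : ℤ) (L' : List ℤ) : List ℤ → List (ℤˣ × Multiplicative ℤ)
  | [] => L'.reverse.map fun j => (-1, Multiplicative.ofAdd (-j))
  | _ :: L => (1, Multiplicative.ofAdd (L.headD m)) :: syllables m L' L

theorem isChain_syllables {m : ℤ} {L L' : List ℤ} (h : IsPinchFree c L m L') :
    (syllables m L' L).IsChain fun x y =>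
      x.2 ∈ HNNExtension.toSubgroup (mulSubgroup c) (mulSubgroup d) x.1 → x.1 = y.1 := by
  induction L with
  | nil =>
    refine List.Pairwise.isChain ?_
    rw [syllables, List.pairwise_map]
    exact List.pairwise_of_forall fun _ _ _ => rfl
  | cons i L ih =>
    rw [syllables, List.isChain_cons]
    refine ⟨fun y hy => ?_, ih h.tail⟩
    cases L with
    | nil =>
      intro hm
      have hne : L' ≠ [] := by
        rintro rfl
        simp [syllables] at hy
      exact absurd (ofAdd_mem_mulSubgroup.1 hm) (h (List.cons_ne_nil _ _) hne)
    | cons j L =>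
      simp only [syllables, List.head?_cons, Option.mem_def, Option.some.injEq] at hy
      exact fun _ => by rw [← hy]

theorem prod_syllables (m : ℤ) (L L' : List ℤ) :
    extBase hc hd ^ L.headD m * ((syllables m L' L).map fun x =>
        (HNNExtension.t : BSExtension hc hd) ^ (x.1 : ℤ) * HNNExtension.of x.2).prod =
      posWord HNNExtension.t (extBase hc hd) L * extBase hc hd ^ m *
        (posWord HNNExtension.t (extBase hc hd) L')⁻¹ := by
  induction L with
  | nil =>
    simp only [syllables, posWord_nil, List.headD_nil, one_mul, mul_right_inj]
    induction L' with
    | nil => simp [posWord]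
    | cons j L' ih =>
      simp only [List.reverse_cons, List.map_append, List.prod_append, ih, posWord_cons,
        mul_inv_rev]
      simp [of_ofAdd]
  | cons i L ih =>
    simp only [syllables, List.map_cons, List.prod_cons, List.headD_cons, posWord_cons, of_ofAdd,
      mul_assoc, Units.val_one, zpow_one] at ih ⊢
    rw [ih]

theorem map_fst_syllables (m : ℤ) (L L' : List ℤ) :
    (syllables m L' L).map Prod.fst =
      List.replicate L.length 1 ++ List.replicate L'.length (-1) := by
  induction L with
  | nil => simp [syllables, Function.comp_def]
  | cons i L ih => simp [syllables, ih, List.replicate_succ]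

/-- Britton's lemma for pinch-free words `posWord L * b ^ m * (posWord L')⁻¹`. -/
theorem length_eq_and_dvd_of_posWord_eq {L L' M M' : List ℤ} {m n : ℤ}
    (hL : IsPinchFree c L m L') (hM : IsPinchFree c M n M')
    (h : posWord HNNExtension.t (extBase hc hd) L * extBase hc hd ^ m *
        (posWord HNNExtension.t (extBase hc hd) L')⁻¹ =
      posWord HNNExtension.t (extBase hc hd) M * extBase hc hd ^ n *
        (posWord HNNExtension.t (extBase hc hd) M')⁻¹) :
    L.length = M.length ∧ (L ≠ [] → d ∣ M.headD n - L.headD m) := by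
  have h' := HNNExtension.ReducedWord.map_fst_eq_and_of_prod_eq (mulSubgroupEquiv hc hd)
    (w₁ := ⟨Multiplicative.ofAdd (L.headD m), syllables m L' L, isChain_syllables hL⟩)
    (w₂ := ⟨Multiplicative.ofAdd (M.headD n), syllables n M' M, isChain_syllables hM⟩)
    (by
      simp only [HNNExtension.NormalWord.ReducedWord.prod, of_ofAdd]
      rw [prod_syllables, prod_syllables, h])
  refine ⟨?_, fun hne => ?_⟩
  · have h₁ := h'.1
    simp only [map_fst_syllables] at h₁
    have h₂ := congrArg (List.count (1 : ℤˣ)) h₁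
    simpa [List.count_replicate] using h₂
  · obtain ⟨i, L, rfl⟩ := List.exists_cons_of_ne_nil hne
    have h₁ := h'.2 1 (by simp [syllables])
    rw [HNNExtension.toSubgroup_neg_one, ← ofAdd_neg, ← ofAdd_add, ofAdd_mem_mulSubgroup] at h₁
    rwa [sub_eq_neg_add]

theorem posWord_left_unique {L L' M M' : List ℤ} {m n : ℤ}
    (hdL : IsDigitList d L) (hdM : IsDigitList d M)
    (hL : IsPinchFree c L m L') (hM : IsPinchFree c M n M')
    (h : posWord HNNExtension.t (extBase hc hd) L * extBase hc hd ^ m *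
        (posWord HNNExtension.t (extBase hc hd) L')⁻¹ =
      posWord HNNExtension.t (extBase hc hd) M * extBase hc hd ^ n *
        (posWord HNNExtension.t (extBase hc hd) M')⁻¹) : L = M := by
  induction L generalizing M with
  | nil =>
    have := (length_eq_and_dvd_of_posWord_eq hc hd hL hM h).1
    exact (List.length_eq_zero_iff.1 this.symm).symm
  | cons i L ih =>
    obtain ⟨hlen, hdvd⟩ := length_eq_and_dvd_of_posWord_eq hc hd hL hM h
    cases M with
    | nil => simp at hlen
    | cons j M =>
      have hi := hdL i (by simp)
      have hj := hdM j (by simp)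
      have hij : i = j := by
        have h0 := Int.eq_zero_of_abs_lt_dvd (hdvd (List.cons_ne_nil _ _))
          (by simp only [List.headD_cons]; rw [abs_lt]; lia)
        simp only [List.headD_cons] at h0
        lia
      subst hij
      rw [ih (fun k hk => hdL k (by simp [hk])) (fun k hk => hdM k (by simp [hk])) hL.tail hM.tail
        (by simpa only [posWord_cons, mul_assoc, mul_right_inj] using h)]

theorem extBase_zpow_injective : Function.Injective fun m : ℤ => extBase hc hd ^ m := by
  intro m n h
  simp only [← of_ofAdd] at h
  exact Multiplicative.ofAdd.injective (HNNExtension.of_injective _ h)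

theorem isPinchFree_nil (c m : ℤ) (L : List ℤ) : IsPinchFree c L m [] :=
  fun _ h => absurd rfl h

theorem posWord_unique (hc : 0 < c) (hd : 0 < d) {L L' M M' : List ℤ} {m n : ℤ}
    (hdL : IsDigitList d L) (hdL' : IsDigitList d L')
    (hdM : IsDigitList d M) (hdM' : IsDigitList d M')
    (hL : IsPinchFree c L m L') (hM : IsPinchFree c M n M')
    (h : posWord (bsa c d) (bsb c d) L * bsb c d ^ m * (posWord (bsa c d) (bsb c d) L')⁻¹ =
      posWord (bsa c d) (bsb c d) M * bsb c d ^ n * (posWord (bsa c d) (bsb c d) M')⁻¹) :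
    L = M ∧ L' = M' ∧ m = n := by
  have h₁ := congrArg (toExtension hc hd) h
  simp only [map_mul, map_inv, map_zpow, map_posWord, toExtension_bsa, toExtension_bsb] at h₁
  obtain rfl := posWord_left_unique hc hd hdL hdM hL hM h₁
  rw [mul_assoc, mul_assoc, mul_right_inj] at h₁
  have h₂ := congrArg (·⁻¹) h₁
  simp only [mul_inv_rev, inv_inv, ← zpow_neg] at h₂
  obtain rfl := posWord_left_unique hc hd (L' := []) (M' := []) hdL' hdM'
    (isPinchFree_nil c _ _) (isPinchFree_nil c _ _) (by simpa only [posWord_nil, inv_one, mul_one])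
  exact ⟨rfl, rfl, extBase_zpow_injective hc hd (mul_right_cancel h₁)⟩

end Britton

/-- In cases (BS1) and (BS2) (relation `a b^c = b^d a` with `c, d ≥ 1`), the ordered group
`(Γ, Λ)` is quasi-lattice ordered: for every `t ∈ Γ` with `tΛ ∩ Λ ≠ ∅` there is `α ∈ Λ`
with `tΛ ∩ Λ = αΛ`. -/
theorem statement10 (c d : ℤ) (hc : 0 < c) (hd : 0 < d)
    (t : BSGroup c d)
    (ht : ∃ x : BSGroup c d, (∃ l ∈ bsΛ c d, x = t * l) ∧ x ∈ bsΛ c d) :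
    ∃ α ∈ bsΛ c d, ∀ x : BSGroup c d,
      ((∃ l ∈ bsΛ c d, x = t * l) ∧ x ∈ bsΛ c d) ↔ ∃ l ∈ bsΛ c d, x = α * l := by
  obtain ⟨u, ⟨v, hv, huv⟩, hu⟩ := ht
  obtain ⟨L, L', m, hL, hL', hred, z, -, hz, hz'⟩ := exists_isPinchFree_of_mem hc hd hu hv
  have ht : t = posWord (bsa c d) (bsb c d) L * bsb c d ^ m *
      (posWord (bsa c d) (bsb c d) L')⁻¹ := by
    rw [← mul_zpow_max_mul_inv, eq_mul_inv_iff_mul_eq, ← mul_left_inj z, mul_assoc, ← hz, ← hz',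
      huv]
  refine ⟨posWord (bsa c d) (bsb c d) L * bsb c d ^ max m 0,
    mul_mem (posWord_mem hL) (bsb_zpow_mem (le_max_right _ _)), fun x => ⟨?_, ?_⟩⟩
  · rintro ⟨⟨l, hl, hxl⟩, hx⟩
    obtain ⟨M, M', n, hM, hM', hred', y, hy, hy₁, hy₂⟩ := exists_isPinchFree_of_mem hc hd hx hl
    have ht' : t = posWord (bsa c d) (bsb c d) M * bsb c d ^ n *
        (posWord (bsa c d) (bsb c d) M')⁻¹ := by
      rw [← mul_zpow_max_mul_inv, eq_mul_inv_iff_mul_eq, ← mul_left_inj y, mul_assoc, ← hy₁, ← hy₂,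
        hxl]
    obtain ⟨rfl, rfl, rfl⟩ :=
      posWord_unique hc hd hL hL' hM hM' hred hred' (ht.symm.trans ht')
    exact ⟨y, hy, hy₁⟩
  · rintro ⟨l, hl, rfl⟩
    refine ⟨⟨posWord (bsa c d) (bsb c d) L' * bsb c d ^ max (-m) 0 * l,
      mul_mem (mul_mem (posWord_mem hL') (bsb_zpow_mem (le_max_right _ _))) hl, ?_⟩,
      mul_mem (mul_mem (posWord_mem hL) (bsb_zpow_mem (le_max_right _ _))) hl⟩
    rw [← mul_assoc, ht, ← mul_zpow_max_mul_inv, inv_mul_cancel_right]
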